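/- Two-sided Lorentzian bounds for the Fourier transform of the cutoff (Appendix Proposition): Define F : ℝ → ℝ by F(τ) = ∫_{−1}^{1} (1 − |s|) e^{−2|s|} cos(τ s) ds. Then there exist constants κ₂ ≥ κ₁ > 0 such that for all τ ∈ ℝ, κ₁ / (1 + τ²) ≤ F(τ) ≤ κ₂ / (1 + τ²). -/

import Mathlib

/-- An even continuous function has integral over `[-a, a]` twice the one over `[0, a]`. -/
theorem integral_neg_self_of_even {f : ℝ → ℝ} (hf : Continuous f) (heven : ∀ x, f (-x) = f x)
    (a : ℝ) : ∫ x in -a..a, f x = 2 * ∫ x in (0:ℝ)..a, f x := by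
  have hneg : ∫ x in -a..0, f x = ∫ x in (0:ℝ)..a, f x := by
    have h := intervalIntegral.integral_comp_neg (a := -a) (b := 0) f
    simpa [heven] using h
  rw [← intervalIntegral.integral_add_adjacent_intervals (b := 0)
    (hf.intervalIntegrable _ _) (hf.intervalIntegrable _ _), hneg]
  ring

/-- An antiderivative of `(1 - s) e^{-2s} cos (τ s)`. -/
theorem hasDerivAt_cutoff_antideriv (τ x : ℝ) :
    HasDerivAt (fun s : ℝ => Real.exp (-2 * s) *
      ((-(1 - s) * 2 / (4 + τ^2) + (4 - τ^2) / (4 + τ^2)^2) * Real.cos (τ * s)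
        - (-(1 - s) * τ / (4 + τ^2) + 4 * τ / (4 + τ^2)^2) * Real.sin (τ * s)))
      ((1 - x) * Real.exp (-2 * x) * Real.cos (τ * x)) x := by
  have hD : (4 + τ^2 : ℝ) ≠ 0 := by positivity
  have hexp : HasDerivAt (fun s : ℝ => Real.exp (-2 * s)) (Real.exp (-2 * x) * (-2 * 1)) x :=
    ((hasDerivAt_id x).const_mul (-2)).exp
  have hcos : HasDerivAt (fun s : ℝ => Real.cos (τ * s)) (-Real.sin (τ * x) * (τ * 1)) x :=
    ((hasDerivAt_id x).const_mul τ).cos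
  have hsin : HasDerivAt (fun s : ℝ => Real.sin (τ * s)) (Real.cos (τ * x) * (τ * 1)) x :=
    ((hasDerivAt_id x).const_mul τ).sin
  have hlin (b c : ℝ) :
      HasDerivAt (fun s : ℝ => -(1 - s) * b / (4 + τ^2) + c) (b / (4 + τ^2)) x := by
    have h := (((((hasDerivAt_id x).const_sub 1).neg).mul_const b).div_const (4 + τ^2)).add_const c
    simpa using h
  refine (hexp.mul (((hlin 2 _).mul hcos).sub ((hlin τ _).mul hsin))).congr_deriv ?_
  simp only [Pi.mul_apply, Pi.sub_apply]
  field_simp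
  ring

/-- Closed form of the Fourier transform of the cutoff. -/
theorem integral_cutoff_mul_cos (τ : ℝ) :
    ∫ s in (-1:ℝ)..1, (1 - |s|) * Real.exp (-2 * |s|) * Real.cos (τ * s) =
      2 * (4 + 3 * τ^2 + Real.exp (-2) * ((4 - τ^2) * Real.cos τ - 4 * τ * Real.sin τ))
        / (4 + τ^2)^2 := by
  have hD : (4 + τ^2 : ℝ) ≠ 0 := by positivity
  rw [integral_neg_self_of_even (by fun_prop) (by simp)]
  have habs : ∫ s in (0:ℝ)..1, (1 - |s|) * Real.exp (-2 * |s|) * Real.cos (τ * s) =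
      ∫ s in (0:ℝ)..1, (1 - s) * Real.exp (-2 * s) * Real.cos (τ * s) := by
    refine intervalIntegral.integral_congr fun s hs => ?_
    rw [Set.uIcc_of_le zero_le_one] at hs
    simp only [abs_of_nonneg hs.1]
  rw [habs, intervalIntegral.integral_eq_sub_of_hasDerivAt
    (fun x _ => hasDerivAt_cutoff_antideriv τ x)
    (Continuous.intervalIntegrable (by fun_prop) _ _)]
  simp only [mul_one, mul_zero, Real.exp_zero, Real.cos_zero, Real.sin_zero]
  field_simp
  ring

/-- The oscillating term in the closed form is at most `4 + τ²` in absolute value. -/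
theorem abs_oscillation_le (τ : ℝ) :
    |(4 - τ^2) * Real.cos τ - 4 * τ * Real.sin τ| ≤ 4 + τ^2 := by
  refine abs_le_of_sq_le_sq ?_ (by positivity)
  have hsq : ((4 - τ^2) * Real.cos τ - 4 * τ * Real.sin τ)^2
      + ((4 - τ^2) * Real.sin τ + 4 * τ * Real.cos τ)^2 = (4 + τ^2)^2 := by
    linear_combination (4 + τ^2)^2 * Real.sin_sq_add_cos_sq τ
  nlinarith [sq_nonneg ((4 - τ^2) * Real.sin τ + 4 * τ * Real.cos τ)]

/-- Two-sided Lorentzian bounds for the Fourier transform of the cutoff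
`χ(s) = (1 − |s|) e^{−2|s|} 1_{(−1,1)}(s)` (Appendix Proposition). -/
theorem stmt13 :
    ∃ κ₁ κ₂ : ℝ, 0 < κ₁ ∧ κ₁ ≤ κ₂ ∧
      ∀ τ : ℝ,
        κ₁ / (1 + τ^2) ≤
          (∫ s in (-1:ℝ)..1, (1 - |s|) * Real.exp (-2 * |s|) * Real.cos (τ * s)) ∧
        (∫ s in (-1:ℝ)..1, (1 - |s|) * Real.exp (-2 * |s|) * Real.cos (τ * s)) ≤
          κ₂ / (1 + τ^2) := by
  refine ⟨1 / 4, 8, by norm_num, by norm_num, fun τ => ?_⟩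
  rw [integral_cutoff_mul_cos]
  have hexp : Real.exp (-2) ≤ 1 / 2 := by
    rw [Real.exp_neg, ← one_div]
    exact one_div_le_one_div_of_le two_pos (by linarith [Real.add_one_le_exp (2:ℝ)])
  have hosc : |Real.exp (-2) * ((4 - τ^2) * Real.cos τ - 4 * τ * Real.sin τ)|
      ≤ 1 / 2 * (4 + τ^2) := by
    rw [abs_mul, Real.abs_exp]
    exact mul_le_mul hexp (abs_oscillation_le τ) (abs_nonneg _) (by norm_num)
  obtain ⟨hlow, hupp⟩ := abs_le.mp hosc
  have hτ := sq_nonneg τ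
  constructor
  · rw [div_le_div_iff₀ (by positivity) (by positivity)]
    nlinarith
  · rw [div_le_div_iff₀ (by positivity) (by positivity)]
    nlinarith
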